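/- Let β ≥ 1 and β' ≥ 1 be ordinals, and let H, H' : Ordinal → Prop be predicates such that: for all δ with 1 ≤ δ ≤ β, (∀γ < δ, H γ) implies H δ; for all δ with 1 ≤ δ ≤ β', (∀γ < δ, H' γ) implies H' δ; and H β ↔ H' 0. Define H'' : Ordinal → Prop by H'' τ = H τ if τ ≤ β, and H'' τ = H' (τ ∸ β) if τ > β, where ∸ is left subtraction. Then H'' 0 ↔ H 0, H'' (β + β') ↔ H' β', and for all δ with 1 ≤ δ ≤ β + β', (∀γ < δ, H'' γ) implies H'' δ. -/

import Mathlib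

open scoped Classical

/-- Gluing two ordinal flows: the flow `H` of length `β` followed by the flow `H'`
(shifted past `β`, using left subtraction of ordinals). -/
noncomputable def glueFlow (β : Ordinal) (H H' : Ordinal → Prop) : Ordinal → Prop :=
  fun τ => if τ ≤ β then H τ else H' (τ - β)

theorem glueFlow_of_le {β τ : Ordinal} (H H' : Ordinal → Prop) (h : τ ≤ β) :
    glueFlow β H H' τ ↔ H τ := by
  simp [glueFlow, h]

theorem glueFlow_add {β : Ordinal} {H H' : Ordinal → Prop} (hlink : H β ↔ H' 0) (γ : Ordinal) :
    glueFlow β H H' (β + γ) ↔ H' γ := by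
  rcases eq_or_ne γ 0 with rfl | hγ
  · simpa [glueFlow] using hlink
  · have h : ¬ β + γ ≤ β := by simpa using hγ
    simp [glueFlow, h]

/-- Gluing of ordinal flows: if `H` is progressive on `[1, β]`, `H'` is progressive on
`[1, β']`, and `H β ↔ H' 0`, then the glued predicate `H''` satisfies `H'' 0 ↔ H 0`,
`H'' (β + β') ↔ H' β'`, and is progressive on `[1, β + β']`. -/
theorem glue_flows (β β' : Ordinal) (hβ : 1 ≤ β) (hβ' : 1 ≤ β')
    (H H' : Ordinal → Prop)
    (hH : ∀ δ, 1 ≤ δ → δ ≤ β → (∀ γ < δ, H γ) → H δ)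
    (hH' : ∀ δ, 1 ≤ δ → δ ≤ β' → (∀ γ < δ, H' γ) → H' δ)
    (hlink : H β ↔ H' 0) :
    (glueFlow β H H' 0 ↔ H 0) ∧
    (glueFlow β H H' (β + β') ↔ H' β') ∧
    (∀ δ, 1 ≤ δ → δ ≤ β + β' → (∀ γ < δ, glueFlow β H H' γ) → glueFlow β H H' δ) := by
  refine ⟨glueFlow_of_le H H' (zero_le_one.trans hβ), glueFlow_add hlink β', ?_⟩
  intro δ hδ hδ' hprev
  rcases le_or_gt δ β with hle | hlt
  · rw [glueFlow_of_le H H' hle]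
    exact hH δ hδ hle fun γ hγ => (glueFlow_of_le H H' (hγ.le.trans hle)).1 (hprev γ hγ)
  · obtain ⟨ε, rfl⟩ := exists_add_of_le hlt.le
    have hε : 1 ≤ ε := by
      rw [Order.one_le_iff_pos]
      simpa using hlt
    rw [glueFlow_add hlink]
    refine hH' ε hε (by simpa using hδ') fun γ hγ => ?_
    exact (glueFlow_add hlink γ).1 (hprev _ (by simpa using hγ))
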